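/- Let A, B be nonnegative real symmetric n×n matrices and α₁,…,α_m, β₁,…,β_m nonnegative vectors in ℝ^n. Suppose that for every subset S ⊆ {1,…,m} with |S| ≤ 2, the matrices A + Σ_{i∈S} α_i α_i^T and B + Σ_{i∈S} β_i β_i^T are similar. Then there exists an orthogonal matrix Q such that Q^T A Q = B and Q^T α_i = β_i for all i = 1,…,m. -/

import Mathlib

open Matrix

theorem gram_matrix_aux {ι : Type*} {n : ℕ} (a b : ι → Fin n → ℝ)
    (h : ∀ i j, a i ⬝ᵥ a j = b i ⬝ᵥ b j) :
    ∃ M : Matrix (Fin n) (Fin n) ℝ, Mᵀ * M = 1 ∧ ∀ i, M *ᵥ a i = b i := by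
  classical
  let Ta : (ι →₀ ℝ) →ₗ[ℝ] EuclideanSpace ℝ (Fin n) := Finsupp.linearCombination ℝ (fun i => WithLp.toLp 2 (a i))
  let Tb : (ι →₀ ℝ) →ₗ[ℝ] EuclideanSpace ℝ (Fin n) := Finsupp.linearCombination ℝ (fun i => WithLp.toLp 2 (b i))
  have hinner : ∀ f, inner ℝ (Ta f) (Ta f) = inner ℝ (Tb f) (Tb f) := by
    intro f
    simp only [Ta, Tb, Finsupp.linearCombination_apply, Finsupp.sum, sum_inner, inner_sum,
      real_inner_smul_left, real_inner_smul_right, EuclideanSpace.inner_toLp_toLp, star_trivial, h]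
  have hnorm : ∀ f, ‖Tb f‖ = ‖Ta f‖ := by
    intro f
    have := hinner f
    rw [real_inner_self_eq_norm_sq, real_inner_self_eq_norm_sq] at this
    exact ((sq_eq_sq₀ (norm_nonneg _) (norm_nonneg _)).1 this).symm
  obtain ⟨s, hs⟩ := Ta.rangeRestrict.exists_rightInverse_of_surjective Ta.range_rangeRestrict
  have hs' : ∀ y : LinearMap.range Ta, Ta (s y) = y := fun y => by
    have := congrArg Subtype.val (LinearMap.congr_fun hs y)
    simpa using this
  let L0 : LinearMap.range Ta →ₗᵢ[ℝ] EuclideanSpace ℝ (Fin n) :=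
    { toLinearMap := Tb ∘ₗ s
      norm_map' := fun y => by
        change ‖Tb (s y)‖ = ‖y‖
        rw [hnorm, hs']; rfl }
  let L := L0.extend
  have hL : ∀ f, L (Ta f) = Tb f := by
    intro f
    have h1 : L (Ta f) = L0 ⟨Ta f, f, rfl⟩ := L0.extend_apply ⟨Ta f, f, rfl⟩
    rw [h1]
    change Tb (s _) = _
    rw [← sub_eq_zero, ← map_sub, ← norm_eq_zero, hnorm, map_sub, hs']
    simp
  refine ⟨Matrix.of fun i j => L (WithLp.toLp 2 (Pi.single j 1)) i, ?_, ?_⟩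
  · ext i j
    have h1 := L.inner_map_map (WithLp.toLp 2 (Pi.single j 1)) (WithLp.toLp 2 (Pi.single i 1))
    simp only [PiLp.inner_apply] at h1
    simp only [Matrix.mul_apply, Matrix.transpose_apply, Matrix.of_apply]
    simp only [RCLike.inner_apply, conj_trivial] at h1
    rw [h1]
    simp [Matrix.one_apply, Pi.single_apply, eq_comm]
  · intro i
    have h1 := hL (Finsupp.single i 1)
    simp only [Ta, Tb, Finsupp.linearCombination_single, one_smul] at h1
    have h2 : WithLp.toLp 2 (a i) = ∑ j, a i j • (WithLp.toLp 2 (Pi.single j 1) : EuclideanSpace ℝ (Fin n)) := by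
      ext k
      simp [Pi.single_apply]
    rw [h2, map_sum] at h1
    ext l
    have h3 := congrArg (fun v : EuclideanSpace ℝ (Fin n) => v l) h1
    simp only [map_smul] at h3
    simp only [Matrix.mulVec, dotProduct, Matrix.of_apply]
    simpa [mul_comm] using h3

theorem block_aux {ι : Type*} {n : ℕ} (d : Fin n → ℝ) (a b : ι → Fin n → ℝ)
    (h : ∀ t i j, ∑ l, (if d l = t then a i l * a j l else 0) =
      ∑ l, (if d l = t then b i l * b j l else 0)) :
    ∃ Q : Matrix (Fin n) (Fin n) ℝ, Qᵀ * Q = 1 ∧ Q * diagonal d = diagonal d * Q ∧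
      ∀ i, Q *ᵥ a i = b i := by
  classical
  have key : ∀ t : ℝ, ∃ M : Matrix (Fin n) (Fin n) ℝ, Mᵀ * M = 1 ∧
      (∀ i, M *ᵥ (fun l => if d l = t then a i l else 0) = fun l => if d l = t then b i l else 0) ∧
      (∀ l, d l ≠ t → M *ᵥ Pi.single l 1 = Pi.single l 1) := by
    intro t
    obtain ⟨M, hM, hM2⟩ := gram_matrix_aux
      (Sum.elim (fun i l => if d l = t then a i l else 0)
        (fun l : {l // d l ≠ t} => Pi.single l.1 1))
      (Sum.elim (fun i l => if d l = t then b i l else 0)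
        (fun l : {l // d l ≠ t} => Pi.single l.1 1)) (by
        rintro (i | ⟨i, hi⟩) (j | ⟨j, hj⟩)
        · have := h t i j
          simpa [dotProduct, ← ite_and] using this
        · simp [hj]
        · simp [hi]
        · simp)
    exact ⟨M, hM, fun i => hM2 (Sum.inl i), fun l hl => hM2 (Sum.inr ⟨l, hl⟩)⟩
  choose M hM hMa hMs using key
  have hrow : ∀ t l k, d l ≠ t → l ≠ k → M t l k = 0 := by
    intro t l k hl hk
    have h1 : (M t)ᵀ *ᵥ (M t *ᵥ Pi.single l 1) = Pi.single l 1 := by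
      rw [Matrix.mulVec_mulVec, hM, Matrix.one_mulVec]
    rw [hMs t l hl] at h1
    have := congrFun h1 k
    simpa [Pi.single_apply, hk.symm] using this
  have hZ : ∀ l k, d l ≠ d k → M (d k) l k = 0 := fun l k hlk =>
    hrow _ _ _ hlk (fun e => hlk (by rw [e]))
  refine ⟨Matrix.of fun l k => M (d k) l k, ?_, ?_, ?_⟩
  · ext k k'
    simp only [Matrix.mul_apply, Matrix.transpose_apply, Matrix.of_apply]
    by_cases e : d k = d k'
    · have := congrFun (congrFun (hM (d k')) k) k'
      rw [Matrix.mul_apply] at this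
      simpa [e] using this
    · have hk : k ≠ k' := fun e' => e (by rw [e'])
      rw [Matrix.one_apply_ne hk]
      apply Finset.sum_eq_zero
      intro l _
      by_cases e1 : d l = d k
      · rw [hZ l k' (by rw [e1]; exact e), mul_zero]
      · rw [hZ l k e1, zero_mul]
  · ext l k
    simp only [Matrix.mul_diagonal, Matrix.diagonal_mul, Matrix.of_apply]
    by_cases e1 : d l = d k
    · rw [e1, mul_comm]
    · rw [hZ l k e1]; simp
  · intro i
    ext l
    have := congrFun (hMa (d l) i) l
    simp only [if_true] at this
    rw [← this]
    simp only [Matrix.mulVec, dotProduct, Matrix.of_apply]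
    apply Finset.sum_congr rfl
    intro k _
    by_cases e1 : d k = d l
    · rw [e1]; simp
    · rw [hZ l k (Ne.symm e1)]; simp [e1]

theorem det_aux {n : ℕ} (d u v : Fin n → ℝ) (x : ℝ) (hx : ∀ l, d l < x) :
    (diagonal d + (vecMulVec u u + vecMulVec v v)).charpoly.eval x =
      (∏ l, (x - d l)) * ((1 - ∑ l, u l * u l / (x - d l)) * (1 - ∑ l, v l * v l / (x - d l))
        - (∑ l, u l * v l / (x - d l)) ^ 2) := by
  rw [Matrix.eval_charpoly]
  let U : Matrix (Fin n) (Fin 2) ℝ := Matrix.of fun l c => if c = 0 then u l else v l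
  have h1 : Matrix.scalar (Fin n) x - (diagonal d + (vecMulVec u u + vecMulVec v v)) =
      diagonal (fun l => x - d l) + (-U) * Uᵀ := by
    ext i j
    by_cases e : i = j
    · subst e
      simp [U, Matrix.mul_apply, vecMulVec_apply, Fin.sum_univ_two]; ring
    · simp [U, Matrix.mul_apply, vecMulVec_apply, Fin.sum_univ_two, e]; ring
  have hne : ∀ l, x - d l ≠ 0 := fun l => (sub_pos.2 (hx l)).ne'
  have hinv : (diagonal (fun l => x - d l))⁻¹ = diagonal (fun l => (x - d l)⁻¹) := by
    apply Matrix.inv_eq_right_inv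
    rw [Matrix.diagonal_mul_diagonal, ← Matrix.diagonal_one]
    congr 1
    ext l
    exact mul_inv_cancel₀ (hne l)
  rw [h1, Matrix.det_add_mul, hinv, Matrix.det_diagonal, Matrix.det_fin_two]
  · congr 1
    have h2 : ∀ c c', (Uᵀ * diagonal (fun l => (x - d l)⁻¹) * -U) c c' =
        - ∑ l, U l c * U l c' / (x - d l) := by
      intro c c'
      rw [Matrix.mul_apply, ← Finset.sum_neg_distrib]
      apply Finset.sum_congr rfl
      intro l _
      simp [Matrix.mul_diagonal]
      ring
    simp only [Matrix.add_apply, h2]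
    simp only [U, Matrix.of_apply]
    have h5 : ∑ l, v l * u l / (x - d l) = ∑ l, u l * v l / (x - d l) :=
      Finset.sum_congr rfl fun l _ => by rw [mul_comm (v l)]
    simp [h5]
    ring
  · rw [Matrix.det_diagonal]
    exact (Finset.prod_ne_zero_iff.2 fun l _ => hne l).isUnit

theorem residue_aux {n : ℕ} (d c : Fin n → ℝ) (N : ℝ) (hN : ∀ l, d l < N)
    (h : ∀ x, N < x → ∑ l, c l / (x - d l) = 0) (t : ℝ) :
    ∑ l, (if d l = t then c l else 0) = 0 := by
  classical
  by_cases ht : ∀ l, d l ≠ t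
  · exact Finset.sum_eq_zero fun l _ => by simp [ht l]
  push Not at ht
  obtain ⟨l0, hl0⟩ := ht
  let s := Finset.univ.image d
  have hts : t ∈ s := hl0 ▸ Finset.mem_image_of_mem d (Finset.mem_univ l0)
  let p : Polynomial ℝ := ∑ l, Polynomial.C (c l) *
    ∏ y ∈ s.erase (d l), (Polynomial.X - Polynomial.C y)
  have hp : p = 0 := by
    apply Polynomial.eq_zero_of_infinite_isRoot
    apply (Set.Ioi_infinite N).mono
    intro x hx
    have hx' : N < x := hx
    have h0 := h x hx'
    change p.eval x = 0
    have : p.eval x = (∏ y ∈ s, (x - y)) * ∑ l, c l / (x - d l) := by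
      simp only [p, Polynomial.eval_finsetSum, Polynomial.eval_mul, Polynomial.eval_C,
        Polynomial.eval_prod, Polynomial.eval_sub, Polynomial.eval_X, Finset.mul_sum]
      apply Finset.sum_congr rfl
      intro l _
      have hm : d l ∈ s := Finset.mem_image_of_mem d (Finset.mem_univ l)
      rw [← Finset.mul_prod_erase s _ hm]
      have : x - d l ≠ 0 := (by linarith [hN l] : 0 < x - d l).ne'
      field_simp
    rw [this, h0, mul_zero]
  have he : p.eval t = (∏ y ∈ s.erase t, (t - y)) * ∑ l, (if d l = t then c l else 0) := by
    simp only [p, Polynomial.eval_finsetSum, Polynomial.eval_mul, Polynomial.eval_C,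
        Polynomial.eval_prod, Polynomial.eval_sub, Polynomial.eval_X, Finset.mul_sum]
    apply Finset.sum_congr rfl
    intro l _
    by_cases e : d l = t
    · simp [e, mul_comm]
    · have : ∏ y ∈ s.erase (d l), (t - y) = 0 :=
        Finset.prod_eq_zero (Finset.mem_erase.2 ⟨Ne.symm e, hts⟩) (sub_self t)
      simp [e, this]
  rw [hp, Polynomial.eval_zero] at he
  have := mul_eq_zero.1 he.symm
  refine this.resolve_left ?_
  apply Finset.prod_ne_zero_iff.2
  intro y hy
  exact sub_ne_zero.2 (Finset.ne_of_mem_erase hy).symm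

theorem nonneg_aux {n : ℕ} (d c : Fin n → ℝ) (x : ℝ) (hx : ∀ l, |d l| < x) (hx0 : 0 < x)
    (h : ∀ k : ℕ, 0 ≤ ∑ l, c l * d l ^ k) : 0 ≤ ∑ l, c l / (x - d l) := by
  have h1 : ∀ l, HasSum (fun k : ℕ => c l / x * (d l / x) ^ k) (c l / (x - d l)) := by
    intro l
    have hlt : ‖d l / x‖ < 1 := by
      rw [Real.norm_eq_abs, abs_div, abs_of_pos hx0, div_lt_one hx0]
      exact hx l
    have := (hasSum_geometric_of_norm_lt_one hlt).mul_left (c l / x)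
    have h3 : x - d l ≠ 0 := 
      (by linarith [hx l, le_abs_self (d l)] : 0 < x - d l).ne'
    have h4 : 1 - d l / x = (x - d l) / x := by field_simp
    have h5 : c l / x * (1 - d l / x)⁻¹ = c l / (x - d l) := by
      rw [h4]
      field_simp
    rwa [h5] at this
  have h2 := hasSum_sum (s := Finset.univ) (fun l _ => h1 l)
  refine h2.nonneg fun k => ?_
  have : ∑ l, c l / x * (d l / x) ^ k = (∑ l, c l * d l ^ k) / x ^ (k + 1) := by
    rw [Finset.sum_div]
    apply Finset.sum_congr rfl
    intro l _
    rw [div_pow, pow_succ]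
    field_simp
  rw [this]
  exact div_nonneg (h k) (by positivity)

theorem diag_aux {n : ℕ} (A : Matrix (Fin n) (Fin n) ℝ) (hA : A.IsHermitian) :
    ∃ U : Matrix (Fin n) (Fin n) ℝ, Uᵀ * U = 1 ∧ U * Uᵀ = 1 ∧
      A = U * diagonal hA.eigenvalues * Uᵀ := by
  have h1 := hA.spectral_theorem
  rw [Unitary.conjStarAlgAut_apply] at h1
  refine ⟨hA.eigenvectorUnitary, ?_, ?_, ?_⟩
  · have := Unitary.coe_star_mul_self hA.eigenvectorUnitary
    rwa [Matrix.star_eq_conjTranspose, Matrix.conjTranspose_eq_transpose_of_trivial] at this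
  · have := Unitary.coe_mul_star_self hA.eigenvectorUnitary
    rwa [Unitary.coe_star, Matrix.star_eq_conjTranspose, Matrix.conjTranspose_eq_transpose_of_trivial] at this
  · rw [Matrix.star_eq_conjTranspose, Matrix.conjTranspose_eq_transpose_of_trivial] at h1
    exact h1

theorem charpoly_aux {n : ℕ} (U D M : Matrix (Fin n) (Fin n) ℝ) (h1 : Uᵀ * U = 1)
    (h2 : U * Uᵀ = 1) : (U * D * Uᵀ + M).charpoly = (D + Uᵀ * M * U).charpoly := by
  have : U * D * Uᵀ + M = U * ((D + Uᵀ * M * U) * Uᵀ) := by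
    rw [Matrix.add_mul, Matrix.mul_add]
    simp only [Matrix.mul_assoc, h2, Matrix.mul_one]
    rw [← Matrix.mul_assoc U Uᵀ, h2, Matrix.one_mul]
  rw [this, Matrix.charpoly_mul_comm, Matrix.mul_assoc, h1, Matrix.mul_one]

theorem conj_aux {n : ℕ} (U : Matrix (Fin n) (Fin n) ℝ) (u v : Fin n → ℝ) :
    Uᵀ * vecMulVec u v * U = vecMulVec (Uᵀ *ᵥ u) (Uᵀ *ᵥ v) := by
  rw [Matrix.mul_vecMulVec, Matrix.vecMulVec_mul, Matrix.mulVec_transpose U v]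

theorem moment_aux {n : ℕ} (A U : Matrix (Fin n) (Fin n) ℝ) (d u v : Fin n → ℝ)
    (h1 : Uᵀ * U = 1) (h2 : U * Uᵀ = 1)
    (hA : A = U * diagonal d * Uᵀ) (hAnn : ∀ i j, 0 ≤ A i j) (hu : ∀ i, 0 ≤ u i)
    (hv : ∀ i, 0 ≤ v i) (k : ℕ) :
    0 ≤ ∑ l, ((Uᵀ *ᵥ u) l * (Uᵀ *ᵥ v) l) * d l ^ k := by
  have hk : ∀ w, (∀ i, 0 ≤ w i) → ∀ i, 0 ≤ ((A ^ k) *ᵥ w) i := by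
    induction k with
    | zero => intro w hw i; simpa using hw i
    | succ k ih =>
      intro w hw i
      rw [pow_succ, ← Matrix.mulVec_mulVec]
      exact ih (A *ᵥ w) (fun j => by
        simp only [Matrix.mulVec, dotProduct]
        exact Finset.sum_nonneg fun l _ => mul_nonneg (hAnn j l) (hw l)) i
  have hp : A ^ k = U * diagonal (fun l => d l ^ k) * Uᵀ := by
    clear hk
    induction k with
    | zero => simp [h2]
    | succ k ih =>
      rw [pow_succ, ih, hA]
      calc _ = U * diagonal (fun l => d l ^ k) * (Uᵀ * U) * diagonal d * Uᵀ := by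
            simp only [Matrix.mul_assoc]
        _ = _ := by
            rw [h1, Matrix.mul_one, Matrix.mul_assoc U, Matrix.diagonal_mul_diagonal]
            simp only [pow_succ]
  have h3 : 0 ≤ u ⬝ᵥ (A ^ k *ᵥ v) :=
    Finset.sum_nonneg fun i _ => mul_nonneg (hu i) (hk v hv i)
  have h4 : u ⬝ᵥ (A ^ k *ᵥ v) = ∑ l, ((Uᵀ *ᵥ u) l * (Uᵀ *ᵥ v) l) * d l ^ k := by
    rw [hp, ← Matrix.mulVec_mulVec, ← Matrix.mulVec_mulVec, Matrix.dotProduct_mulVec,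
      ← Matrix.mulVec_transpose]
    simp only [dotProduct, Matrix.mulVec_diagonal]
    apply Finset.sum_congr rfl
    intro l _
    ring
  rwa [h4] at h3

theorem stmt_13 (n m : ℕ) (A B : Matrix (Fin n) (Fin n) ℝ)
    (hA : A.IsSymm) (hB : B.IsSymm)
    (hAnn : ∀ i j, 0 ≤ A i j) (hBnn : ∀ i j, 0 ≤ B i j)
    (α β : Fin m → Fin n → ℝ)
    (hαnn : ∀ i j, 0 ≤ α i j) (hβnn : ∀ i j, 0 ≤ β i j)
    (h : ∀ S : Finset (Fin m), S.card ≤ 2 →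
      (A + ∑ i ∈ S, Matrix.vecMulVec (α i) (α i)).charpoly =
      (B + ∑ i ∈ S, Matrix.vecMulVec (β i) (β i)).charpoly) :
    ∃ Q : Matrix (Fin n) (Fin n) ℝ, Qᵀ * Q = 1 ∧ Qᵀ * A * Q = B ∧
      ∀ i, Qᵀ.mulVec (α i) = β i := by
  have hA' : A.IsHermitian := by
    rw [Matrix.IsHermitian, Matrix.conjTranspose_eq_transpose_of_trivial]; exact hA
  have hB' : B.IsHermitian := by
    rw [Matrix.IsHermitian, Matrix.conjTranspose_eq_transpose_of_trivial]; exact hB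
  obtain ⟨U, hU1, hU2, hU⟩ := diag_aux A hA'
  obtain ⟨W, hW1, hW2, hW⟩ := diag_aux B hB'
  have hev : hA'.eigenvalues = hB'.eigenvalues := by
    rw [Matrix.IsHermitian.eigenvalues_eq_eigenvalues_iff]
    simpa using h ∅ (by simp)
  rw [← hev] at hW
  generalize hA'.eigenvalues = d at hU hW
  clear hev
  set a : Fin m → Fin n → ℝ := fun i => Uᵀ *ᵥ α i with ha
  set b : Fin m → Fin n → ℝ := fun i => Wᵀ *ᵥ β i with hb
  have hc : ∀ S : Finset (Fin m), S.card ≤ 2 →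
      (diagonal d + ∑ i ∈ S, vecMulVec (a i) (a i)).charpoly =
      (diagonal d + ∑ i ∈ S, vecMulVec (b i) (b i)).charpoly := by
    intro S hS
    have := h S hS
    rw [hU, hW, charpoly_aux U _ _ hU1 hU2, charpoly_aux W _ _ hW1 hW2] at this
    simpa only [Matrix.mul_sum, Matrix.sum_mul, conj_aux] using this
  obtain ⟨N, hN0, hN⟩ : ∃ N : ℝ, 0 ≤ N ∧ ∀ l, |d l| < N := by
    refine ⟨1 + ∑ l, |d l|, by positivity, fun l => ?_⟩
    have := Finset.single_le_sum (f := fun l => |d l|) (fun i _ => abs_nonneg _)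
      (Finset.mem_univ l)
    linarith
  have hdN : ∀ l, d l < N := fun l => (le_abs_self _).trans_lt (hN l)
  have hprod : ∀ x, N < x → (∏ l, (x - d l)) ≠ 0 := fun x hx =>
    Finset.prod_ne_zero_iff.2 fun l _ => (sub_pos.2 ((hdN l).trans hx)).ne'
  have hdiag : ∀ i x, N < x →
      ∑ l, a i l * a i l / (x - d l) = ∑ l, b i l * b i l / (x - d l) := by
    intro i x hx
    have h1 := congrArg (Polynomial.eval x) (hc {i} (by simp))
    rw [Finset.sum_singleton, Finset.sum_singleton] at h1
    have h2 := det_aux d (a i) 0 x (fun l => (hdN l).trans hx)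
    have h3 := det_aux d (b i) 0 x (fun l => (hdN l).trans hx)
    simp only [Matrix.vecMulVec_zero, add_zero] at h2 h3
    rw [h2, h3] at h1
    have h4 := mul_left_cancel₀ (hprod x hx) h1
    simp at h4
    linarith
  have hall : ∀ i j x, N < x →
      ∑ l, a i l * a j l / (x - d l) = ∑ l, b i l * b j l / (x - d l) := by
    intro i j x hx
    by_cases e : i = j
    · subst e; exact hdiag i x hx
    have h1 := congrArg (Polynomial.eval x) (hc {i, j} Finset.card_le_two)
    rw [Finset.sum_pair e, Finset.sum_pair e, det_aux d _ _ x (fun l => (hdN l).trans hx),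
      det_aux d _ _ x (fun l => (hdN l).trans hx)] at h1
    have h4 := mul_left_cancel₀ (hprod x hx) h1
    rw [hdiag i x hx, hdiag j x hx] at h4
    have hx' : ∀ l, |d l| < x := fun l => (hN l).trans hx
    refine (sq_eq_sq₀ ?_ ?_).1 (by linarith)
    · exact nonneg_aux d (fun l => a i l * a j l) x hx' (by linarith)
        (moment_aux A U d _ _ hU1 hU2 hU hAnn (hαnn i) (hαnn j))
    · exact nonneg_aux d (fun l => b i l * b j l) x hx' (by linarith)
        (moment_aux B W d _ _ hW1 hW2 hW hBnn (hβnn i) (hβnn j))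
  obtain ⟨Q, hQ1, hQd, hQ⟩ := block_aux d a b (by
    intro t i j
    have := residue_aux d (fun l => a i l * a j l - b i l * b j l) N hdN (by
      intro x hx
      simp only [sub_div, Finset.sum_sub_distrib, hall i j x hx, sub_self]) t
    rw [← sub_eq_zero, ← Finset.sum_sub_distrib, ← this]
    apply Finset.sum_congr rfl
    intro l _
    split_ifs <;> simp)
  have hQ2 : Q * Qᵀ = 1 := mul_eq_one_comm.1 hQ1
  have hT : (U * Qᵀ * Wᵀ)ᵀ = W * Q * Uᵀ := by
    simp [Matrix.transpose_mul, Matrix.mul_assoc]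
  refine ⟨U * Qᵀ * Wᵀ, ?_, ?_, ?_⟩
  · rw [hT]
    calc _ = W * (Q * (Uᵀ * U) * Qᵀ) * Wᵀ := by simp only [Matrix.mul_assoc]
      _ = 1 := by rw [hU1, Matrix.mul_one, hQ2, Matrix.mul_one, hW2]
  · rw [hT, hU]
    calc _ = W * (Q * (Uᵀ * U) * diagonal d * (Uᵀ * U) * Qᵀ) * Wᵀ := by
          simp only [Matrix.mul_assoc]
      _ = W * (diagonal d * (Q * Qᵀ)) * Wᵀ := by
          rw [hU1, Matrix.mul_one, Matrix.mul_one, hQd, Matrix.mul_assoc (diagonal d)]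
      _ = B := by rw [hQ2, Matrix.mul_one, hW]
  · intro i
    rw [hT, ← Matrix.mulVec_mulVec, ← Matrix.mulVec_mulVec]
    have : Q *ᵥ (Uᵀ *ᵥ α i) = Wᵀ *ᵥ β i := hQ i
    rw [this, Matrix.mulVec_mulVec, hW2, Matrix.one_mulVec]
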